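/- arXiv:2010.05726 — 11 statements merged into one kernel-verified Lean document; each statement's English description precedes it below -/
import Mathlib

section
/- Let S, T : E → E be operators with Fix T ∩ Fix S ≠ ∅. If S is quasi α-firmly nonexpansive for some α ∈ (0,1) and T is quasi nonexpansive, then Fix (T ∘ S) = Fix T ∩ Fix S. -/
open RealInnerProductSpace

/-- If `‖v‖² + (1 - 2α)‖u‖² ≤ 2(1 - α)⟪u, v⟫` with `α ∈ (0, 1)` and `‖u‖ ≤ ‖v‖`,
then `u = v`. -/
theorem eq_of_firm_inequality_of_norm_le
    {E : Type*} [NormedAddCommGroup E] [InnerProductSpace ℝ E] {u v : E} {α : ℝ}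
    (hα : α ∈ Set.Ioo (0 : ℝ) 1)
    (h : ‖v‖ ^ 2 + (1 - 2 * α) * ‖u‖ ^ 2 ≤ 2 * (1 - α) * ⟪u, v⟫)
    (huv : ‖u‖ ≤ ‖v‖) : u = v := by
  have hsq : ‖u‖ ^ 2 ≤ ‖v‖ ^ 2 := by gcongr
  have hle : (1 - α) * ‖u - v‖ ^ 2 ≤ α * (‖u‖ ^ 2 - ‖v‖ ^ 2) := by
    rw [norm_sub_sq_real]
    linarith
  have hmul : (1 - α) * ‖u - v‖ ^ 2 ≤ 0 :=
    hle.trans (mul_nonpos_of_nonneg_of_nonpos hα.1.le (sub_nonpos.2 hsq))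
  have hzero : ‖u - v‖ ^ 2 ≤ 0 := nonpos_of_mul_nonpos_right hmul (sub_pos.2 hα.2)
  exact sub_eq_zero.1 (norm_eq_zero.1 (pow_eq_zero_iff two_ne_zero |>.1
    (hzero.antisymm (sq_nonneg _))))

theorem fixedPoints_comp_eq_inter
    {E : Type*} [NormedAddCommGroup E] [InnerProductSpace ℝ E]
    (S T : E → E) (α : ℝ) (hα : α ∈ Set.Ioo (0 : ℝ) 1)
    (hinter : ({x : E | T x = x} ∩ {x : E | S x = x}).Nonempty)
    (hS : ∀ x : E, ∀ y ∈ {x : E | S x = x},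
      ‖S x - S y‖ ^ 2 + (1 - 2 * α) * ‖x - y‖ ^ 2 ≤
        2 * (1 - α) * ⟪x - y, S x - S y⟫)
    (hT : ∀ x : E, ∀ y ∈ {x : E | T x = x}, ‖T x - y‖ ≤ ‖x - y‖) :
    {x : E | (T ∘ S) x = x} = {x : E | T x = x} ∩ {x : E | S x = x} := by
  ext x
  simp only [Function.comp_apply, Set.mem_ofPred_eq, Set.mem_inter_iff]
  refine ⟨fun hx => ?_, fun ⟨hTx, hSx⟩ => by rw [hSx, hTx]⟩
  obtain ⟨y, hTy, hSy⟩ := hinter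
  have hfirm := hS x y hSy
  rw [show S y = y from hSy] at hfirm
  have hle : ‖x - y‖ ≤ ‖S x - y‖ := by simpa only [hx] using hT (S x) y hTy
  have hSx : S x = x := (sub_left_inj.1 (eq_of_firm_inequality_of_norm_le hα hfirm hle)).symm
  exact ⟨by rwa [hSx] at hx, hSx⟩
end

section
/- Let S : E → E be α-firmly nonexpansive with constant α_S ∈ (0,1) and T : E → E be α-firmly nonexpansive with constant α_T ∈ (0,1). For x, y ∈ E define L(x,y) := ‖(x − y) − (S x − S y)‖^2, M(x,y) := ‖(S x − S y) − (T(S x) − T(S y))‖^2, and U(x,y) := ⟨x − y, T(S x) − T(S y)⟩ + ‖S x − S y‖^2 − ⟨x − y, S x − S y⟩ − ⟨S x − S y, T(S x) − T(S y)⟩, and set τ := (1 − α_S)/α_S + (1 − α_T)/α_T. If ((1 − α_S)/(τ α_S))^2 · L(x,y) + ((1 − α_T)/(τ α_T))^2 · M(x,y) + 2·((1 − α_S)/(τ α_S))·((1 − α_T)/(τ α_T))·U(x,y) ≥ 0 for all x, y ∈ E, then the composition T ∘ S is α-firmly nonexpansive with constant α_{TS} = (α_S + α_T − 2 α_S α_T)/(1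 − α_S α_T). -/
open RealInnerProductSpace

/-- In an inner product space, the composition of averaged operators satisfies the firm
nonexpansiveness inequality, in terms of the increments `a`, `b`, `c` of the identity, the inner
operator and the composition. -/
theorem comp_firmly_nonexpansive_increment
    {E : Type*} [NormedAddCommGroup E] [InnerProductSpace ℝ E] {α β : ℝ}
    (hα : α ∈ Set.Ioo (0 : ℝ) 1) (hβ : β ∈ Set.Ioo (0 : ℝ) 1) {a b c : E}
    (hab : ‖b‖ ^ 2 + (1 - 2 * α) * ‖a‖ ^ 2 ≤ 2 * (1 - α) * ⟪a, b⟫)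
    (hbc : ‖c‖ ^ 2 + (1 - 2 * β) * ‖b‖ ^ 2 ≤ 2 * (1 - β) * ⟪b, c⟫) :
    ‖c‖ ^ 2 + (1 - 2 * ((α + β - 2 * α * β) / (1 - α * β))) * ‖a‖ ^ 2 ≤
      2 * (1 - (α + β - 2 * α * β) / (1 - α * β)) * ⟪a, c⟫ := by
  obtain ⟨hα0, hα1⟩ := hα
  obtain ⟨hβ0, hβ1⟩ := hβ
  have hD : 0 < 1 - α * β := by nlinarith
  have hN : 0 < α + β - 2 * α * β := by
    nlinarith [mul_pos hα0 (sub_pos.2 hβ1), mul_pos hβ0 (sub_pos.2 hα1)]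
  have hsq : 0 ≤ ‖(β * (1 - α)) • (a - b) - (α * (1 - β)) • (b - c)‖ ^ 2 := sq_nonneg _
  simp only [← real_inner_self_eq_norm_sq, inner_sub_left, inner_sub_right,
    real_inner_smul_left, real_inner_smul_right, real_inner_comm a b, real_inner_comm b c,
    real_inner_comm a c] at hab hbc hsq ⊢
  have hab' := mul_le_mul_of_nonneg_left hab (mul_pos hN hβ0).le
  have hbc' := mul_le_mul_of_nonneg_left hbc (mul_pos hN hα0).le
  have key : (1 - α * β) * ⟪c, c⟫ + (1 - α * β - 2 * (α + β - 2 * α * β)) * ⟪a, a⟫ ≤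
      2 * ((1 - α) * (1 - β)) * ⟪a, c⟫ := by
    refine le_of_mul_le_mul_left ?_ (mul_pos hα0 hβ0)
    linarith
  refine le_of_mul_le_mul_left ?_ hD
  linear_combination key + 2 * (⟪a, c⟫ - ⟪a, a⟫) * mul_div_cancel₀ (α + β - 2 * α * β) hD.ne'

theorem comp_alpha_firmly_nonexpansive
    {E : Type*} [NormedAddCommGroup E] [InnerProductSpace ℝ E]
    (S T : E → E) (αS αT : ℝ)
    (hαS : αS ∈ Set.Ioo (0 : ℝ) 1) (hαT : αT ∈ Set.Ioo (0 : ℝ) 1)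
    (hS : ∀ x y : E,
      ‖S x - S y‖ ^ 2 + (1 - 2 * αS) * ‖x - y‖ ^ 2 ≤
        2 * (1 - αS) * ⟪x - y, S x - S y⟫)
    (hT : ∀ x y : E,
      ‖T x - T y‖ ^ 2 + (1 - 2 * αT) * ‖x - y‖ ^ 2 ≤
        2 * (1 - αT) * ⟪x - y, T x - T y⟫)
    (τ : ℝ) (hτ : τ = (1 - αS) / αS + (1 - αT) / αT)
    (hmain : ∀ x y : E,
      ((1 - αS) / (τ * αS)) ^ 2 * ‖(x - y) - (S x - S y)‖ ^ 2 +
        ((1 - αT) / (τ * αT)) ^ 2 * ‖(S x - S y) - (T (S x) - T (S y))‖ ^ 2 +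
        2 * ((1 - αS) / (τ * αS)) * ((1 - αT) / (τ * αT)) *
          (⟪x - y, T (S x) - T (S y)⟫ + ‖S x - S y‖ ^ 2 -
            ⟪x - y, S x - S y⟫ - ⟪S x - S y, T (S x) - T (S y)⟫) ≥ 0) :
    ∀ x y : E,
      ‖(T ∘ S) x - (T ∘ S) y‖ ^ 2 +
          (1 - 2 * ((αS + αT - 2 * αS * αT) / (1 - αS * αT))) * ‖x - y‖ ^ 2 ≤
        2 * (1 - (αS + αT - 2 * αS * αT) / (1 - αS * αT)) *
          ⟪x - y, (T ∘ S) x - (T ∘ S) y⟫ := by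
  intro x y
  exact comp_firmly_nonexpansive_increment hαS hαT (hS x y) (hT (S x) (S y))
end

section
/- Let S : E → E be quasi α-firmly nonexpansive with constant α_S ∈ (0,1), let T : E → E be quasi α-firmly nonexpansive with constant α_T ∈ (0,1), and suppose Fix T ∩ Fix S ≠ ∅. Then the composition T ∘ S is quasi α-firmly nonexpansive with constant α_{TS} = (α_S + α_T − 2 α_S α_T)/(1 − α_S α_T), and α_{TS} ∈ (0,1). -/
open RealInnerProductSpace

section

variable {E : Type*} [NormedAddCommGroup E] [InnerProductSpace ℝ E]

/-- The `α`-firmness inequality between `u` and `v`, in terms of the residual `u - v`. -/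
theorem firm_ineq_iff_residual (u v : E) (a : ℝ) :
    ‖v‖ ^ 2 + (1 - 2 * a) * ‖u‖ ^ 2 ≤ 2 * (1 - a) * ⟪u, v⟫ ↔
      a * ‖v‖ ^ 2 + (1 - a) * ‖u - v‖ ^ 2 ≤ a * ‖u‖ ^ 2 := by
  rw [norm_sub_sq_real]
  constructor <;> intro h <;> linarith

/-- A weighted Young inequality for the norm of a sum. -/
theorem mul_norm_add_sq_le (p q : E) (s t : ℝ) :
    s * t * ‖p + q‖ ^ 2 ≤ (s + t) * (s * ‖p‖ ^ 2 + t * ‖q‖ ^ 2) := by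
  have h := sq_nonneg ‖s • p - t • q‖
  rw [norm_sub_sq_real, norm_smul, norm_smul, real_inner_smul_left, real_inner_smul_right,
    mul_pow, mul_pow, Real.norm_eq_abs, Real.norm_eq_abs, sq_abs, sq_abs] at h
  rw [norm_add_sq_real]
  linarith

/-- Composition of two residual inequalities. -/
theorem residual_ineq_trans {u v w : E} {a b : ℝ} (ha : a ∈ Set.Ioo (0 : ℝ) 1)
    (hb : b ∈ Set.Ioo (0 : ℝ) 1)
    (huv : a * ‖v‖ ^ 2 + (1 - a) * ‖u - v‖ ^ 2 ≤ a * ‖u‖ ^ 2)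
    (hvw : b * ‖w‖ ^ 2 + (1 - b) * ‖v - w‖ ^ 2 ≤ b * ‖v‖ ^ 2) :
    (a + b - 2 * a * b) * ‖w‖ ^ 2 + (1 - a) * (1 - b) * ‖u - w‖ ^ 2 ≤
      (a + b - 2 * a * b) * ‖u‖ ^ 2 := by
  obtain ⟨ha0, ha1⟩ := ha
  obtain ⟨hb0, hb1⟩ := hb
  have young := mul_norm_add_sq_le (u - v) (v - w) (b * (1 - a)) (a * (1 - b))
  rw [sub_add_sub_cancel] at young
  have hpos : 0 ≤ b * (1 - a) + a * (1 - b) :=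
    add_nonneg (mul_nonneg hb0.le (sub_nonneg.2 ha1.le)) (mul_nonneg ha0.le (sub_nonneg.2 hb1.le))
  have h₁ := mul_le_mul_of_nonneg_left huv (mul_nonneg hpos hb0.le)
  have h₂ := mul_le_mul_of_nonneg_left hvw (mul_nonneg hpos ha0.le)
  refine le_of_mul_le_mul_left ?_ (mul_pos ha0 hb0)
  linarith

end

/-- If the residual inequality holds and the norm does not decrease, the two vectors agree. -/
theorem eq_of_residual_ineq {E : Type*} [NormedAddCommGroup E] {u v : E} {a : ℝ}
    (ha : a ∈ Set.Ioo (0 : ℝ) 1)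
    (h : a * ‖v‖ ^ 2 + (1 - a) * ‖u - v‖ ^ 2 ≤ a * ‖u‖ ^ 2) (huv : ‖u‖ ^ 2 ≤ ‖v‖ ^ 2) :
    u = v := by
  have h₁ := mul_le_mul_of_nonneg_left huv ha.1.le
  have h₂ : (1 - a) * ‖u - v‖ ^ 2 ≤ 0 := by linarith
  have h₃ : ‖u - v‖ ^ 2 ≤ 0 := nonpos_of_mul_nonpos_right h₂ (sub_pos.2 ha.2)
  exact sub_eq_zero.1 (norm_eq_zero.1 (pow_eq_zero_iff two_ne_zero |>.1
    (le_antisymm h₃ (sq_nonneg _))))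

theorem comp_quasi_alpha_firmly_nonexpansive
    {E : Type*} [NormedAddCommGroup E] [InnerProductSpace ℝ E]
    (S T : E → E) (αS αT : ℝ)
    (hαS : αS ∈ Set.Ioo (0 : ℝ) 1) (hαT : αT ∈ Set.Ioo (0 : ℝ) 1)
    (hS : ∀ x : E, ∀ y ∈ {x : E | S x = x},
      ‖S x - S y‖ ^ 2 + (1 - 2 * αS) * ‖x - y‖ ^ 2 ≤
        2 * (1 - αS) * ⟪x - y, S x - S y⟫)
    (hT : ∀ x : E, ∀ y ∈ {x : E | T x = x},
      ‖T x - T y‖ ^ 2 + (1 - 2 * αT) * ‖x - y‖ ^ 2 ≤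
        2 * (1 - αT) * ⟪x - y, T x - T y⟫)
    (hinter : ({x : E | T x = x} ∩ {x : E | S x = x}).Nonempty) :
    (αS + αT - 2 * αS * αT) / (1 - αS * αT) ∈ Set.Ioo (0 : ℝ) 1 ∧
    {x : E | (T ∘ S) x = x}.Nonempty ∧
    (∀ x : E, ∀ y ∈ {x : E | (T ∘ S) x = x},
      ‖(T ∘ S) x - (T ∘ S) y‖ ^ 2 +
          (1 - 2 * ((αS + αT - 2 * αS * αT) / (1 - αS * αT))) * ‖x - y‖ ^ 2 ≤
        2 * (1 - (αS + αT - 2 * αS * αT) / (1 - αS * αT)) *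
          ⟪x - y, (T ∘ S) x - (T ∘ S) y⟫) := by
  obtain ⟨p, hTp, hSp⟩ := hinter
  have hS' : ∀ x y, S y = y →
      αS * ‖S x - y‖ ^ 2 + (1 - αS) * ‖(x - y) - (S x - y)‖ ^ 2 ≤ αS * ‖x - y‖ ^ 2 := by
    intro x y hy
    have h := hS x y hy
    rwa [hy, firm_ineq_iff_residual] at h
  have hT' : ∀ x y, T y = y →
      αT * ‖T x - y‖ ^ 2 + (1 - αT) * ‖(x - y) - (T x - y)‖ ^ 2 ≤ αT * ‖x - y‖ ^ 2 := by
    intro x y hy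
    have h := hT x y hy
    rwa [hy, firm_ineq_iff_residual] at h
  have hden : 0 < 1 - αS * αT := by nlinarith [hαS.1, hαS.2, hαT.1, hαT.2]
  have hcompl : 0 < (1 - αS) * (1 - αT) := mul_pos (sub_pos.2 hαS.2) (sub_pos.2 hαT.2)
  have hnum : 0 < αS + αT - 2 * αS * αT := by
    linarith [mul_pos hαS.1 (sub_pos.2 hαT.2), mul_pos hαT.1 (sub_pos.2 hαS.2)]
  refine ⟨⟨div_pos hnum hden, (div_lt_one hden).2 (by linarith)⟩,
    ⟨p, (congrArg T hSp).trans hTp⟩, ?_⟩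
  intro x y hy
  have hTSy : T (S y) = y := hy
  have hSy : S y = y := by
    have h := hT' (S y) p hTp
    rw [hTSy] at h
    have hle : ‖y - p‖ ^ 2 ≤ ‖S y - p‖ ^ 2 := by
      refine le_of_mul_le_mul_left ?_ hαT.1
      linarith [mul_nonneg (sub_nonneg.2 hαT.2.le) (sq_nonneg ‖(S y - p) - (y - p)‖)]
    exact (sub_left_injective (eq_of_residual_ineq hαS (hS' y p hSp) hle)).symm
  have hTy : T y = y := by rwa [hSy] at hTSy
  have key := residual_ineq_trans hαS hαT (hS' x y hSy) (hT' (S x) y hTy)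
  have hsub : 1 - (αS + αT - 2 * αS * αT) / (1 - αS * αT) =
      (1 - αS) * (1 - αT) / (1 - αS * αT) := by
    field_simp
    ring
  rw [show (T ∘ S) y = y from hy, firm_ineq_iff_residual, hsub, Function.comp_apply,
    div_mul_eq_mul_div, div_mul_eq_mul_div, div_mul_eq_mul_div, ← add_div]
  exact div_le_div_of_nonneg_right key hden.le
end

section
/- Let (T_i)_{i=1}^N be a finite family of operators T_i : E → E, each quasi α-firmly nonexpansive with constant α_i ∈ (0,1), and suppose ⋂_{i=1}^N Fix T_i ≠ ∅. Then for any list i_1, …, i_k of pairwise distinct indices from {1, …, N}, the composition T_{i_k} ∘ T_{i_{k−1}} ∘ ⋯ ∘ T_{i_1} is quasi α-firmly nonexpansive with some constant α ∈ (0,1). -/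
open RealInnerProductSpace

/-- `T` is quasi α-firmly nonexpansive with constant `α`. -/
def QuasiAlphaFirmlyNonexpansive {E : Type*} [NormedAddCommGroup E]
    [InnerProductSpace ℝ E] (T : E → E) (α : ℝ) : Prop :=
  {x : E | T x = x}.Nonempty ∧
    ∀ x : E, ∀ y ∈ {x : E | T x = x},
      ‖T x - T y‖ ^ 2 + (1 - 2 * α) * ‖x - y‖ ^ 2 ≤
        2 * (1 - α) * ⟪x - y, T x - T y⟫

/-- The quasi α-firm inequality at a fixed point, as a quantified Fejér-type decrease. -/
theorem alpha_firm_inequality_iff {E : Type*} [NormedAddCommGroup E] [InnerProductSpace ℝ E]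
    {α : ℝ} (x y z : E) :
    ‖z - y‖ ^ 2 + (1 - 2 * α) * ‖x - y‖ ^ 2 ≤ 2 * (1 - α) * ⟪x - y, z - y⟫ ↔
      α * ‖z - y‖ ^ 2 + (1 - α) * ‖x - z‖ ^ 2 ≤ α * ‖x - y‖ ^ 2 := by
  have h : ‖x - z‖ ^ 2 = ‖x - y‖ ^ 2 - 2 * ⟪x - y, z - y⟫ + ‖z - y‖ ^ 2 := by
    rw [← norm_sub_sq_real, sub_sub_sub_cancel_right]
  rw [h]
  constructor <;> intro h' <;> linarith

/-- Some constant in `(0, 1)` works exactly when the squared distance to fixed points decreases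
by a positive multiple of the squared displacement. -/
theorem exists_quasiAlphaFirmlyNonexpansive_iff {E : Type*} [NormedAddCommGroup E]
    [InnerProductSpace ℝ E] {T : E → E} :
    (∃ α ∈ Set.Ioo (0 : ℝ) 1, QuasiAlphaFirmlyNonexpansive T α) ↔
      {x : E | T x = x}.Nonempty ∧ ∃ κ > (0 : ℝ), ∀ x y : E, T y = y →
        ‖T x - y‖ ^ 2 + κ * ‖x - T x‖ ^ 2 ≤ ‖x - y‖ ^ 2 := by
  constructor
  · rintro ⟨α, ⟨h0, h1⟩, hne, hT⟩
    refine ⟨hne, (1 - α) / α, div_pos (sub_pos.2 h1) h0, fun x y hy => ?_⟩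
    have h := hT x y hy
    rw [hy, alpha_firm_inequality_iff] at h
    refine le_of_mul_le_mul_left ?_ h0
    calc α * (‖T x - y‖ ^ 2 + (1 - α) / α * ‖x - T x‖ ^ 2)
        = α * ‖T x - y‖ ^ 2 + (1 - α) * ‖x - T x‖ ^ 2 := by field_simp
      _ ≤ α * ‖x - y‖ ^ 2 := h
  · rintro ⟨hne, κ, hκ, hT⟩
    have hα : 0 < 1 / (1 + κ) := by positivity
    refine ⟨1 / (1 + κ), ⟨hα, (div_lt_one (by positivity)).2 (by linarith)⟩, hne, ?_⟩
    rintro x y (hy : T y = y)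
    rw [hy, alpha_firm_inequality_iff]
    calc 1 / (1 + κ) * ‖T x - y‖ ^ 2 + (1 - 1 / (1 + κ)) * ‖x - T x‖ ^ 2
        = 1 / (1 + κ) * (‖T x - y‖ ^ 2 + κ * ‖x - T x‖ ^ 2) := by field_simp; ring
      _ ≤ 1 / (1 + κ) * ‖x - y‖ ^ 2 := mul_le_mul_of_nonneg_left (hT x y hy) hα.le

/-- The composition of two quasi α-firmly nonexpansive operators with a common fixed point is
quasi α-firmly nonexpansive. -/
theorem exists_quasiAlphaFirmlyNonexpansive_comp {E : Type*} [NormedAddCommGroup E]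
    [InnerProductSpace ℝ E] {S R : E → E} {p : E} (hSp : S p = p) (hRp : R p = p)
    (hS : ∃ α ∈ Set.Ioo (0 : ℝ) 1, QuasiAlphaFirmlyNonexpansive S α)
    (hR : ∃ α ∈ Set.Ioo (0 : ℝ) 1, QuasiAlphaFirmlyNonexpansive R α) :
    ∃ α ∈ Set.Ioo (0 : ℝ) 1, QuasiAlphaFirmlyNonexpansive (S ∘ R) α := by
  rw [exists_quasiAlphaFirmlyNonexpansive_iff] at *
  obtain ⟨-, a, ha, hS⟩ := hS
  obtain ⟨-, b, hb, hR⟩ := hR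
  refine ⟨⟨p, by simp [hSp, hRp]⟩, min a b / 2, by positivity, fun x y hy => ?_⟩
  simp only [Function.comp_apply] at hy ⊢
  have hRy : R y = y := by
    have h1 := hS (R y) p hSp
    have h2 := hR y p hRp
    rw [hy] at h1
    have h3 : b * ‖y - R y‖ ^ 2 ≤ 0 := by
      have : 0 ≤ a * ‖R y - y‖ ^ 2 := by positivity
      linarith
    have h4 : ‖y - R y‖ ^ 2 ≤ 0 := nonpos_of_mul_nonpos_right h3 hb
    have h5 : ‖y - R y‖ = 0 := pow_eq_zero_iff two_ne_zero |>.1 (le_antisymm h4 (sq_nonneg _))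
    exact (sub_eq_zero.1 (norm_eq_zero.1 h5)).symm
  have hSy : S y = y := by rwa [hRy] at hy
  have h1 := hS (R x) y hSy
  have h2 := hR x y hRy
  have htri : ‖x - S (R x)‖ ^ 2 ≤ 2 * (‖x - R x‖ ^ 2 + ‖R x - S (R x)‖ ^ 2) :=
    (pow_le_pow_left₀ (norm_nonneg _) (norm_sub_le_norm_sub_add_norm_sub x (R x) _) 2).trans
      add_sq_le
  have h3 : min a b / 2 * ‖x - S (R x)‖ ^ 2 ≤
      min a b * ‖x - R x‖ ^ 2 + min a b * ‖R x - S (R x)‖ ^ 2 :=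
    (mul_le_mul_of_nonneg_left htri (by positivity)).trans_eq (by ring)
  have h4 : min a b * ‖x - R x‖ ^ 2 ≤ b * ‖x - R x‖ ^ 2 := by gcongr; exact min_le_right a b
  have h5 : min a b * ‖R x - S (R x)‖ ^ 2 ≤ a * ‖R x - S (R x)‖ ^ 2 := by
    gcongr; exact min_le_left a b
  linarith

theorem comp_family_quasi_alpha_firmly_nonexpansive
    {E : Type*} [NormedAddCommGroup E] [InnerProductSpace ℝ E]
    (N : ℕ) (T : Fin N → E → E) (α : Fin N → ℝ)
    (hα : ∀ i, α i ∈ Set.Ioo (0 : ℝ) 1)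
    (hT : ∀ i, QuasiAlphaFirmlyNonexpansive (T i) (α i))
    (hinter : (⋂ i, {x : E | T i x = x}).Nonempty)
    (l : List (Fin N)) (hl : l.Nodup) (hlne : l ≠ []) :
    ∃ β ∈ Set.Ioo (0 : ℝ) 1,
      QuasiAlphaFirmlyNonexpansive
        (l.foldl (fun (f : E → E) i => T i ∘ f) id) β := by
  obtain ⟨p, hp⟩ := hinter
  have hp : ∀ i, T i p = p := fun i => Set.mem_iInter.1 hp i
  refine (List.foldlRecOn (motive := fun f : E → E => f p = p ∧
    ∃ β ∈ Set.Ioo (0 : ℝ) 1, QuasiAlphaFirmlyNonexpansive f β) l _ ⟨rfl, ?_⟩ ?_).2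
  · exact exists_quasiAlphaFirmlyNonexpansive_iff.2 ⟨⟨p, rfl⟩, 1, one_pos, by simp⟩
  · rintro f ⟨hfp, hf⟩ i -
    exact ⟨by simp [hfp, hp i],
      exists_quasiAlphaFirmlyNonexpansive_comp (hp i) hfp ⟨α i, hα i, hT i⟩ hf⟩
end

section
/- Let T_1, …, T_n : E → E be quasi α-firmly nonexpansive with constants α_1, …, α_n ∈ (0,1), let w_1, …, w_n > 0 with w_1 + ⋯ + w_n = 1, and define the convex combination T : E → E by T x := Σ_{i=1}^n w_i · T_i x. If ⋂_{i=1}^n Fix T_i ≠ ∅, then Fix T = ⋂_{i=1}^n Fix T_i. -/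
open RealInnerProductSpace

/-- The quasi `α`-firm nonexpansiveness inequality at a fixed point `y`, with `t` the image of `x`,
bounds the squared displacement `‖x - t‖ ^ 2`. -/
theorem norm_sub_sq_le_of_quasi_firmly_nonexpansive
    {E : Type*} [NormedAddCommGroup E] [InnerProductSpace ℝ E] {α : ℝ} {x y t : E}
    (h : ‖t - y‖ ^ 2 + (1 - 2 * α) * ‖x - y‖ ^ 2 ≤ 2 * (1 - α) * ⟪x - y, t - y⟫) :
    ‖x - t‖ ^ 2 ≤ 2 * α * ⟪x - y, x - t⟫ := by
  have ht : t - y = (x - y) - (x - t) := by abel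
  rw [ht, norm_sub_sq_real, inner_sub_right (x - y) (x - y), real_inner_self_eq_norm_sq] at h
  linarith

theorem fixedPoints_convex_combination
    {E : Type*} [NormedAddCommGroup E] [InnerProductSpace ℝ E]
    (n : ℕ) (T : Fin n → E → E) (α : Fin n → ℝ) (w : Fin n → ℝ)
    (hα : ∀ i, α i ∈ Set.Ioo (0 : ℝ) 1)
    (hw : ∀ i, 0 < w i) (hwsum : ∑ i, w i = 1)
    (hT : ∀ i, ∀ x : E, ∀ y ∈ {x : E | T i x = x},
      ‖T i x - T i y‖ ^ 2 + (1 - 2 * α i) * ‖x - y‖ ^ 2 ≤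
        2 * (1 - α i) * ⟪x - y, T i x - T i y⟫)
    (hinter : (⋂ i, {x : E | T i x = x}).Nonempty) :
    {x : E | ∑ i, w i • T i x = x} = ⋂ i, {x : E | T i x = x} := by
  obtain ⟨y, hy⟩ := hinter
  simp only [Set.mem_iInter, Set.mem_ofPred_eq] at hy
  ext x
  simp only [Set.mem_iInter, Set.mem_ofPred_eq]
  refine ⟨fun hx => ?_, fun hx => by simp only [hx, ← Finset.sum_smul, hwsum, one_smul]⟩
  have hdisp (i : Fin n) : ‖x - T i x‖ ^ 2 ≤ 2 * α i * ⟪x - y, x - T i x⟫ := by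
    have h := hT i x y (hy i)
    rw [hy i] at h
    exact norm_sub_sq_le_of_quasi_firmly_nonexpansive h
  have hnonneg (i : Fin n) : 0 ≤ ⟪x - y, x - T i x⟫ :=
    nonneg_of_mul_nonneg_right ((sq_nonneg _).trans (hdisp i)) (by linarith [(hα i).1])
  have hsum : ∑ i, w i * ⟪x - y, x - T i x⟫ = 0 := by
    simp only [← real_inner_smul_right, ← inner_sum, smul_sub, Finset.sum_sub_distrib,
      ← Finset.sum_smul, hwsum, one_smul, hx, sub_self, inner_zero_right]
  intro i
  have hzero := (Finset.sum_eq_zero_iff_of_nonneg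
    fun j _ => mul_nonneg (hw j).le (hnonneg j)).1 hsum i (Finset.mem_univ i)
  have hinner := (mul_eq_zero.1 hzero).resolve_left (hw i).ne'
  have h := hdisp i
  rw [hinner, mul_zero] at h
  have hnorm : ‖x - T i x‖ = 0 := pow_eq_zero_iff two_ne_zero |>.1 (h.antisymm (sq_nonneg _))
  exact (sub_eq_zero.1 (norm_eq_zero.1 hnorm)).symm
end

section
/- Let T_1, …, T_n : E → E be quasi α-firmly nonexpansive with constants α_1, …, α_n ∈ (0,1), let w_1, …, w_n > 0 with w_1 + ⋯ + w_n = 1, and suppose ⋂_{i=1}^n Fix T_i ≠ ∅. Then the convex combination T : E → E defined by T x := Σ_{i=1}^n w_i · T_i x is quasi α-firmly nonexpansive with constant α = max{α_1, …, α_n}. -/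
open RealInnerProductSpace

/-- The averaged-type inequality at `y`, expressed through the displacement `u - x`. -/
lemma firmly_nonexpansive_iff_norm_sub_sq_le {E : Type*} [NormedAddCommGroup E]
    [InnerProductSpace ℝ E] (x y u : E) (a : ℝ) :
    ‖u - y‖ ^ 2 + (1 - 2 * a) * ‖x - y‖ ^ 2 ≤ 2 * (1 - a) * ⟪x - y, u - y⟫ ↔
      ‖u - x‖ ^ 2 ≤ -(2 * a) * ⟪x - y, u - x⟫ := by
  have hu : u - x = (u - y) - (x - y) := by abel
  rw [hu, norm_sub_sq_real (u - y) (x - y), inner_sub_right (x - y) (u - y) (x - y),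
    real_inner_self_eq_norm_sq, real_inner_comm (x - y) (u - y)]
  constructor <;> intro h <;> linarith

lemma norm_sum_smul_sq_le {ι E : Type*} [Fintype ι] [NormedAddCommGroup E] [NormedSpace ℝ E]
    (w : ι → ℝ) (hw : ∀ i, 0 ≤ w i) (hwsum : ∑ i, w i = 1) (d : ι → E) :
    ‖∑ i, w i • d i‖ ^ 2 ≤ ∑ i, w i * ‖d i‖ ^ 2 := by
  have hconv : ConvexOn ℝ Set.univ fun v : E => ‖v‖ ^ 2 :=
    (convexOn_univ_norm (E := E)).pow (fun _ _ => norm_nonneg _) 2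
  simpa using hconv.map_sum_le (fun i _ => hw i) hwsum (fun i _ => Set.mem_univ (d i))

theorem convex_combination_quasi_alpha_firmly_nonexpansive
    {E : Type*} [NormedAddCommGroup E] [InnerProductSpace ℝ E]
    (n : ℕ) (hn : 0 < n) (T : Fin n → E → E) (α : Fin n → ℝ) (w : Fin n → ℝ)
    (hα : ∀ i, α i ∈ Set.Ioo (0 : ℝ) 1)
    (hw : ∀ i, 0 < w i) (hwsum : ∑ i, w i = 1)
    (hT : ∀ i, ∀ x : E, ∀ y ∈ {x : E | T i x = x},
      ‖T i x - T i y‖ ^ 2 + (1 - 2 * α i) * ‖x - y‖ ^ 2 ≤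
        2 * (1 - α i) * ⟪x - y, T i x - T i y⟫)
    (hinter : (⋂ i, {x : E | T i x = x}).Nonempty)
    (S : E → E) (hS : ∀ x : E, S x = ∑ i, w i • T i x)
    (β : ℝ) (hβ : β = Finset.univ.sup' (⟨⟨0, hn⟩, Finset.mem_univ _⟩) α) :
    {x : E | S x = x}.Nonempty ∧
    ∀ x : E, ∀ y ∈ {x : E | S x = x},
      ‖S x - S y‖ ^ 2 + (1 - 2 * β) * ‖x - y‖ ^ 2 ≤
        2 * (1 - β) * ⟪x - y, S x - S y⟫ := by
  have hαβ : ∀ i, α i ≤ β := fun i => hβ ▸ Finset.le_sup' α (Finset.mem_univ i)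
  have hdisp : ∀ x, ∑ i, w i • (T i x - x) = S x - x := fun x => by
    simp [smul_sub, Finset.sum_sub_distrib, ← Finset.sum_smul, hwsum, hS]
  have hsum : ∀ x y : E, (∀ i, T i y = y) →
      ∑ i, w i * ‖T i x - x‖ ^ 2 ≤ -(2 * β) * ⟪x - y, S x - x⟫ := by
    intro x y hy
    rw [← hdisp, inner_sum, Finset.mul_sum]
    refine Finset.sum_le_sum fun i _ => ?_
    have h := hT i x y (hy i)
    rw [hy i, firmly_nonexpansive_iff_norm_sub_sq_le] at h
    have hinner : ⟪x - y, T i x - x⟫ ≤ 0 := by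
      by_contra! hpos
      nlinarith [mul_pos (hα i).1 hpos, sq_nonneg ‖T i x - x‖]
    have hβi : ‖T i x - x‖ ^ 2 ≤ -(2 * β) * ⟪x - y, T i x - x⟫ := by
      nlinarith [mul_nonneg (sub_nonneg.2 (hαβ i)) (neg_nonneg.2 hinner)]
    rw [real_inner_smul_right]
    linarith [mul_le_mul_of_nonneg_left hβi (hw i).le]
  obtain ⟨z, hz⟩ := hinter
  replace hz : ∀ i, T i z = z := fun i => Set.mem_iInter.1 hz i
  have hfix : ∀ y, S y = y → ∀ i, T i y = y := by
    intro y hy i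
    have h := hsum y z hz
    rw [hy, sub_self, inner_zero_right, mul_zero] at h
    have hnonneg : ∀ j ∈ Finset.univ, 0 ≤ w j * ‖T j y - y‖ ^ 2 := fun j _ =>
      mul_nonneg (hw j).le (sq_nonneg _)
    have hzero := (Finset.sum_eq_zero_iff_of_nonneg hnonneg).1
      (le_antisymm h (Finset.sum_nonneg hnonneg)) i (Finset.mem_univ i)
    simpa [(hw i).ne', sub_eq_zero] using hzero
  refine ⟨⟨z, ?_⟩, fun x y hy => ?_⟩
  · simp [hS, hz, ← Finset.sum_smul, hwsum]
  · replace hy : S y = y := hy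
    rw [hy, firmly_nonexpansive_iff_norm_sub_sq_le]
    calc ‖S x - x‖ ^ 2 ≤ ∑ i, w i * ‖T i x - x‖ ^ 2 := by
          rw [← hdisp]
          exact norm_sum_smul_sq_le w (fun i => (hw i).le) hwsum _
      _ ≤ _ := hsum x y (hfix y hy)
end

section
/- Let E be a real Hilbert space, C ⊆ E a nonempty closed convex set, and (x_n)_{n≥0} a sequence in E that is Fejér monotone with respect to C. Then (x_n) converges weakly to some x ∈ C if and only if every weak cluster point of (x_n) belongs to C. In that case every weak cluster point of (x_n) equals the weak limit x. -/
open RealInnerProductSpace Filter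

/-- `x` converges weakly to `p` (tested against inner products). -/
def WeakConvergesTo {E : Type*} [NormedAddCommGroup E] [InnerProductSpace ℝ E]
    (x : ℕ → E) (p : E) : Prop :=
  ∀ y : E, Tendsto (fun n => ⟪x n, y⟫) atTop (nhds ⟪p, y⟫)

/-- `z` is a weak cluster point of the sequence `x`. -/
def WeakClusterPoint {E : Type*} [NormedAddCommGroup E] [InnerProductSpace ℝ E]
    (x : ℕ → E) (z : E) : Prop :=
  ∃ φ : ℕ → ℕ, StrictMono φ ∧ WeakConvergesTo (x ∘ φ) z

section WeakConvergence

variable {E : Type*} [NormedAddCommGroup E] [InnerProductSpace ℝ E]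

theorem WeakConvergesTo.comp_strictMono {x : ℕ → E} {p : E} (h : WeakConvergesTo x p)
    {φ : ℕ → ℕ} (hφ : StrictMono φ) : WeakConvergesTo (x ∘ φ) p :=
  fun y => (h y).comp hφ.tendsto_atTop

theorem WeakConvergesTo.unique {x : ℕ → E} {p q : E} (hp : WeakConvergesTo x p)
    (hq : WeakConvergesTo x q) : p = q :=
  ext_inner_right ℝ fun y => tendsto_nhds_unique (hp y) (hq y)

theorem WeakConvergesTo.eq_of_weakClusterPoint {x : ℕ → E} {p z : E}
    (hp : WeakConvergesTo x p) (hz : WeakClusterPoint x z) : z = p := by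
  obtain ⟨φ, hφ, hz⟩ := hz
  exact hz.unique (hp.comp_strictMono hφ)

theorem WeakClusterPoint.of_comp {x : ℕ → E} {z : E} {φ : ℕ → ℕ} (hφ : StrictMono φ)
    (h : WeakClusterPoint (x ∘ φ) z) : WeakClusterPoint x z := by
  obtain ⟨ψ, hψ, hz⟩ := h
  exact ⟨φ ∘ ψ, hφ.comp hψ, hz⟩

/-- A bounded sequence in a Hilbert space has a weak cluster point. -/
theorem exists_weakClusterPoint_of_norm_le [CompleteSpace E] {x : ℕ → E} {R : ℝ}
    (hR : ∀ n, ‖x n‖ ≤ R) : ∃ z, WeakClusterPoint x z := by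
  let K : Submodule ℝ E := (Submodule.span ℝ (Set.range x)).topologicalClosure
  have hxK : ∀ n, x n ∈ K := fun n =>
    Submodule.le_topologicalClosure _ (Submodule.subset_span ⟨n, rfl⟩)
  have : CompleteSpace K := (Submodule.isClosed_topologicalClosure _).completeSpace_coe
  have : TopologicalSpace.SeparableSpace K :=
    ((Set.countable_range x).isSeparable.span (R := ℝ)).closure.separableSpace
  let f : ℕ → WeakDual ℝ K := fun n =>
    StrongDual.toWeakDual (InnerProductSpace.toDual ℝ K ⟨x n, hxK n⟩)
  have hf : ∀ n, f n ∈ WeakDual.toStrongDual ⁻¹' Metric.closedBall (0 : StrongDual ℝ K) R := by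
    intro n
    change InnerProductSpace.toDual ℝ K ⟨x n, hxK n⟩ ∈ Metric.closedBall 0 R
    rw [mem_closedBall_zero_iff, LinearIsometryEquiv.norm_map]
    exact hR n
  obtain ⟨g, -, φ, hφ, hg⟩ := WeakDual.isSeqCompact_closedBall ℝ K 0 R hf
  refine ⟨((InnerProductSpace.toDual ℝ K).symm (WeakDual.toStrongDual g) : K), φ, hφ,
    fun y => ?_⟩
  have h := ((WeakDual.eval_continuous (K.orthogonalProjectionOnto y)).tendsto g).comp hg
  rw [← K.inner_orthogonalProjectionOnto_eq_of_mem_left, InnerProductSpace.toDual_symm_apply]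
  refine h.congr fun n => ?_
  exact K.inner_orthogonalProjectionOnto_eq_of_mem_left ⟨x (φ n), hxK (φ n)⟩ y

/-- A bounded sequence in a Hilbert space with at most one weak cluster point converges weakly
to it. -/
theorem weakConvergesTo_of_forall_weakClusterPoint_eq [CompleteSpace E] {x : ℕ → E} {R : ℝ}
    (hR : ∀ n, ‖x n‖ ≤ R) {p : E} (h : ∀ z, WeakClusterPoint x z → z = p) :
    WeakConvergesTo x p := by
  intro y
  refine tendsto_of_subseq_tendsto fun ns hns => ?_
  obtain ⟨φ, -, hφ⟩ := strictMono_subseq_of_tendsto_atTop hns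
  obtain ⟨z, hz⟩ := exists_weakClusterPoint_of_norm_le (x := x ∘ ns ∘ φ) fun n => hR _
  obtain rfl := h z (hz.of_comp hφ)
  obtain ⟨ψ, -, hψ⟩ := hz
  exact ⟨φ ∘ ψ, hψ y⟩

/-- The **Opial lemma**: two weak cluster points to which the distances of the sequence converge
are equal. -/
theorem WeakClusterPoint.eq_of_tendsto_norm_sub {x : ℕ → E} {z w : E} {a b : ℝ}
    (hz : WeakClusterPoint x z) (hw : WeakClusterPoint x w)
    (ha : Tendsto (fun n => ‖x n - z‖) atTop (nhds a))
    (hb : Tendsto (fun n => ‖x n - w‖) atTop (nhds b)) : z = w := by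
  obtain ⟨φ, hφ, hz⟩ := hz
  obtain ⟨ψ, hψ, hw⟩ := hw
  have hlim : Tendsto (fun n => ⟪x n, z - w⟫) atTop
      (nhds ((b ^ 2 - a ^ 2 + ‖z‖ ^ 2 - ‖w‖ ^ 2) / 2)) := by
    refine (((((hb.pow 2).sub (ha.pow 2)).add_const _).sub_const _).div_const 2).congr
      fun n => ?_
    rw [norm_sub_sq_real, norm_sub_sq_real, inner_sub_right]
    ring
  have h₁ := tendsto_nhds_unique (hz (z - w)) (hlim.comp hφ.tendsto_atTop)
  have h₂ := tendsto_nhds_unique (hw (z - w)) (hlim.comp hψ.tendsto_atTop)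
  rw [← sub_eq_zero, ← inner_self_eq_zero (𝕜 := ℝ), inner_sub_left, h₁, h₂, sub_self]

end WeakConvergence

theorem fejer_monotone_weak_convergence
    {E : Type*} [NormedAddCommGroup E] [InnerProductSpace ℝ E] [CompleteSpace E]
    (C : Set E) (hC : C.Nonempty) (hCc : IsClosed C) (hCv : Convex ℝ C)
    (x : ℕ → E)
    (hfejer : ∀ n : ℕ, ∀ y ∈ C, ‖x (n + 1) - y‖ ≤ ‖x n - y‖) :
    ((∃ p ∈ C, WeakConvergesTo x p) ↔
        ∀ z : E, WeakClusterPoint x z → z ∈ C) ∧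
      ∀ p ∈ C, WeakConvergesTo x p →
        ∀ z : E, WeakClusterPoint x z → z = p := by
  refine ⟨⟨fun ⟨p, hpC, hp⟩ z hz => hp.eq_of_weakClusterPoint hz ▸ hpC, fun h => ?_⟩,
    fun p _ hp z hz => hp.eq_of_weakClusterPoint hz⟩
  have hanti : ∀ y ∈ C, Antitone fun n => ‖x n - y‖ := fun y hy =>
    antitone_nat_of_succ_le fun n => hfejer n y hy
  have hlim : ∀ y ∈ C, ∃ l, Tendsto (fun n => ‖x n - y‖) atTop (nhds l) := fun y hy =>
    ⟨_, tendsto_atTop_ciInf (hanti y hy) ⟨0, by rintro _ ⟨n, rfl⟩; exact norm_nonneg _⟩⟩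
  obtain ⟨c, hc⟩ := hC
  have hR : ∀ n, ‖x n‖ ≤ ‖x 0 - c‖ + ‖c‖ := fun n => by
    linarith [norm_sub_norm_le (x n) c, hanti c hc n.zero_le]
  obtain ⟨p, hp⟩ := exists_weakClusterPoint_of_norm_le hR
  refine ⟨p, h p hp, weakConvergesTo_of_forall_weakClusterPoint_eq hR fun z hz => ?_⟩
  obtain ⟨a, ha⟩ := hlim z (h z hz)
  obtain ⟨b, hb⟩ := hlim p (h p hp)
  exact hz.eq_of_tendsto_norm_sub hp ha hb
end

section
/- Let E be a real Hilbert space and T : E → E a nonexpansive operator that is quasi α-firmly nonexpansive for some α ∈ (0,1). Then for any x_0 ∈ E, the iterates x_n := T x_{n−1} (n ≥ 1) converge weakly to some x* ∈ Fix T. -/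
open RealInnerProductSpace Filter

/-- A bounded family in a Hilbert space converges weakly along every ultrafilter. -/
theorem exists_tendsto_inner_of_ultrafilter
    {E ι : Type*} [NormedAddCommGroup E] [InnerProductSpace ℝ E] [CompleteSpace E]
    (U : Ultrafilter ι) (x : ι → E) (C : ℝ) (hC : ∀ i, ‖x i‖ ≤ C) :
    ∃ p : E, ∀ y : E, Tendsto (fun i => inner ℝ (x i) y) U (nhds (inner ℝ p y)) := by
  have hbound : ∀ y i, |inner ℝ (x i) y| ≤ C * ‖y‖ := fun y i =>
    (abs_real_inner_le_norm _ _).trans (mul_le_mul_of_nonneg_right (hC i) (norm_nonneg y))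
  have hlim : ∀ y : E, ∃ l : ℝ, |l| ≤ C * ‖y‖ ∧
      Tendsto (fun i => inner ℝ (x i) y) U (nhds l) := by
    intro y
    obtain ⟨l, hl, hUl⟩ := (isCompact_Icc (a := -(C * ‖y‖)) (b := C * ‖y‖)).ultrafilter_le_nhds
      (U.map fun i => inner ℝ (x i) y)
      (tendsto_principal.2 (Eventually.of_forall fun i => abs_le.1 (hbound y i)))
    exact ⟨l, abs_le.2 hl, hUl⟩
  choose L hLbound hL using hlim
  let f : E →ₗ[ℝ] ℝ :=
    { toFun := L
      map_add' := fun y z => tendsto_nhds_unique (hL (y + z))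
        (((hL y).add (hL z)).congr fun i => (inner_add_right _ _ _).symm)
      map_smul' := fun c y => tendsto_nhds_unique (hL (c • y))
        (((hL y).const_mul c).congr fun i => (real_inner_smul_right _ _ _).symm) }
  refine ⟨(InnerProductSpace.toDual ℝ E).symm (f.mkContinuous C hLbound), fun y => ?_⟩
  rw [InnerProductSpace.toDual_symm_apply]
  exact hL y

/-- Demiclosedness principle: `id - T` is demiclosed at `0` for nonexpansive `T`. -/
theorem eq_of_tendsto_inner_of_tendsto_norm_sub
    {E ι : Type*} [NormedAddCommGroup E] [InnerProductSpace ℝ E]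
    {l : Filter ι} [l.NeBot] (T : E → E) (hT : ∀ x y : E, ‖T x - T y‖ ≤ ‖x - y‖)
    (x : ι → E) (C : ℝ) (hC : ∀ i, ‖x i‖ ≤ C) (p : E)
    (hp : ∀ y : E, Tendsto (fun i => inner ℝ (x i) y) l (nhds (inner ℝ p y)))
    (hreg : Tendsto (fun i => ‖x i - T (x i)‖) l (nhds 0)) : T p = p := by
  have hle : ∀ i, ‖p - T p‖ ^ 2 ≤ ‖x i - T (x i)‖ ^ 2 + 2 * ‖x i - T (x i)‖ * (C + ‖p‖)
      - 2 * (inner ℝ (x i) (p - T p) - inner ℝ p (p - T p)) := by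
    intro i
    have htri : ‖x i - T p‖ ≤ ‖x i - T (x i)‖ + ‖x i - p‖ :=
      (norm_sub_le_norm_sub_add_norm_sub _ (T (x i)) _).trans (by gcongr; exact hT _ _)
    have hexp : ‖x i - T p‖ ^ 2 =
        ‖x i - p‖ ^ 2 + 2 * inner ℝ (x i - p) (p - T p) + ‖p - T p‖ ^ 2 := by
      rw [← norm_add_sq_real, sub_add_sub_cancel]
    rw [inner_sub_left] at hexp
    have hbd : ‖x i - p‖ ≤ C + ‖p‖ := (norm_sub_le _ _).trans (by gcongr; exact hC i)
    nlinarith [pow_le_pow_left₀ (norm_nonneg _) htri 2,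
      mul_le_mul_of_nonneg_left hbd (norm_nonneg (x i - T (x i)))]
  have hlim : Tendsto (fun i => ‖x i - T (x i)‖ ^ 2 + 2 * ‖x i - T (x i)‖ * (C + ‖p‖)
      - 2 * (inner ℝ (x i) (p - T p) - inner ℝ p (p - T p))) l (nhds 0) := by
    simpa using ((hreg.pow 2).add ((hreg.const_mul 2).mul_const (C + ‖p‖))).sub
      (((hp (p - T p)).sub_const (inner ℝ p (p - T p))).const_mul 2)
  have hsq : ‖p - T p‖ ^ 2 ≤ 0 := ge_of_tendsto' hlim hle
  have hzero : ‖p - T p‖ = 0 := by nlinarith [norm_nonneg (p - T p)]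
  exact (sub_eq_zero.1 (norm_eq_zero.1 hzero)).symm

/-- Opial's argument: two weak cluster points to which the distances converge coincide. -/
theorem eq_of_tendsto_inner_of_tendsto_norm
    {E ι : Type*} [NormedAddCommGroup E] [InnerProductSpace ℝ E]
    {l u v : Filter ι} [u.NeBot] [v.NeBot] (hu : u ≤ l) (hv : v ≤ l) (x : ι → E) (p q : E)
    (hp : ∀ y : E, Tendsto (fun i => inner ℝ (x i) y) u (nhds (inner ℝ p y)))
    (hq : ∀ y : E, Tendsto (fun i => inner ℝ (x i) y) v (nhds (inner ℝ q y)))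
    {a b : ℝ} (ha : Tendsto (fun i => ‖x i - p‖) l (nhds a))
    (hb : Tendsto (fun i => ‖x i - q‖) l (nhds b)) : p = q := by
  have hlim : Tendsto (fun i => inner ℝ (x i) (p - q)) l
      (nhds ((b ^ 2 - a ^ 2 + (‖p‖ ^ 2 - ‖q‖ ^ 2)) / 2)) := by
    refine ((((hb.pow 2).sub (ha.pow 2)).add_const (‖p‖ ^ 2 - ‖q‖ ^ 2)).div_const 2).congr
      fun i => ?_
    rw [norm_sub_sq_real, norm_sub_sq_real, inner_sub_right]
    ring
  have hpq : inner ℝ p (p - q) = inner ℝ q (p - q) :=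
    (tendsto_nhds_unique (hp _) (hlim.mono_left hu)).trans
      (tendsto_nhds_unique (hq _) (hlim.mono_left hv)).symm
  rw [← sub_eq_zero, ← inner_sub_left, inner_self_eq_zero, sub_eq_zero] at hpq
  exact hpq

theorem iterates_weak_convergence
    {E : Type*} [NormedAddCommGroup E] [InnerProductSpace ℝ E] [CompleteSpace E]
    (T : E → E) (α : ℝ) (hα : α ∈ Set.Ioo (0 : ℝ) 1)
    (hnonexp : ∀ x y : E, ‖T x - T y‖ ≤ ‖x - y‖)
    (hne : {x : E | T x = x}.Nonempty)
    (hT : ∀ x : E, ∀ y ∈ {x : E | T x = x},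
      ‖T x - T y‖ ^ 2 + (1 - 2 * α) * ‖x - y‖ ^ 2 ≤
        2 * (1 - α) * ⟪x - y, T x - T y⟫)
    (x₀ : E) (x : ℕ → E) (hx0 : x 0 = x₀)
    (hx : ∀ n : ℕ, x (n + 1) = T (x n)) :
    ∃ xstar ∈ {x : E | T x = x},
      ∀ y : E, Tendsto (fun n => ⟪x n, y⟫) atTop (nhds ⟪xstar, y⟫) := by
  have hanti : ∀ z, T z = z → Antitone fun n => ‖x n - z‖ := fun z hz =>
    antitone_nat_of_succ_le fun n => by
      have h := hnonexp (x n) z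
      rwa [hz, ← hx] at h
  have hdist : ∀ z, T z = z → ∃ a, Tendsto (fun n => ‖x n - z‖) atTop (nhds a) := fun z hz =>
    ⟨_, tendsto_atTop_ciInf (hanti z hz) ⟨0, by rintro _ ⟨n, rfl⟩; exact norm_nonneg _⟩⟩
  obtain ⟨z, hz⟩ := hne
  have hz' : T z = z := hz
  obtain ⟨a, ha⟩ := hdist z hz'
  have hC : ∀ n, ‖x n‖ ≤ ‖x 0 - z‖ + ‖z‖ := fun n => by
    have h := norm_add_le (x n - z) z
    rw [sub_add_cancel] at h
    exact h.trans (by gcongr; exact hanti z hz' (Nat.zero_le n))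
  have hα' : 0 < 1 - α := sub_pos.2 hα.2
  have hle : ∀ n, ‖x n - T (x n)‖ ^ 2 ≤
      α / (1 - α) * (‖x n - z‖ ^ 2 - ‖x (n + 1) - z‖ ^ 2) := by
    intro n
    have h := hT (x n) z hz
    rw [hz', ← hx] at h
    have hexp := norm_sub_sq_real (x n - z) (x (n + 1) - z)
    rw [sub_sub_sub_cancel_right] at hexp
    rw [← hx, div_mul_eq_mul_div, le_div_iff₀ hα', hexp]
    linarith
  have hreg : Tendsto (fun n => ‖x n - T (x n)‖) atTop (nhds 0) := by
    have hlim : Tendsto (fun n => α / (1 - α) * (‖x n - z‖ ^ 2 - ‖x (n + 1) - z‖ ^ 2))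
        atTop (nhds 0) := by
      simpa using ((ha.pow 2).sub (((tendsto_add_atTop_iff_nat 1).2 ha).pow 2)).const_mul
        (α / (1 - α))
    have hsq := squeeze_zero (fun n => sq_nonneg ‖x n - T (x n)‖) hle hlim
    simpa [Real.sqrt_sq] using hsq.sqrt
  have hcluster : ∀ U : Ultrafilter ℕ, (U : Filter ℕ) ≤ atTop → ∃ p, T p = p ∧
      ∀ y : E, Tendsto (fun n => inner ℝ (x n) y) U (nhds (inner ℝ p y)) := by
    intro U hU
    obtain ⟨p, hp⟩ := exists_tendsto_inner_of_ultrafilter U x _ hC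
    exact ⟨p, eq_of_tendsto_inner_of_tendsto_norm_sub T hnonexp x _ hC p hp
      (hreg.mono_left hU), hp⟩
  obtain ⟨p, hpT, hp⟩ := hcluster (Ultrafilter.of atTop) (Ultrafilter.of_le atTop)
  refine ⟨p, hpT, fun y => (tendsto_iff_ultrafilter _ _ _).2 fun U hU => ?_⟩
  obtain ⟨q, hqT, hq⟩ := hcluster U hU
  obtain ⟨b, hb⟩ := hdist p hpT
  obtain ⟨c, hc⟩ := hdist q hqT
  rw [eq_of_tendsto_inner_of_tendsto_norm (Ultrafilter.of_le atTop) hU x p q hp hq hb hc]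
  exact hq y
end

section
/- Let E be a real Hilbert space and T : E → E a nonexpansive operator that is quasi α-firmly nonexpansive for some α ∈ (0,1). Let x_0 ∈ E and x_n := T x_{n−1} for n ≥ 1, and let x* ∈ Fix T be the weak limit of (x_n). Then Fix T is a nonempty closed convex set, and the metric projections P_{Fix T} x_n converge strongly (in norm) to x*: ‖P_{Fix T} x_n − x*‖ → 0 as n → ∞. -/
open RealInnerProductSpace Filter

/-- The fixed point set of a nonexpansive map is closed. -/
theorem isClosed_fixedPoints_of_nonexpansive {E : Type*} [NormedAddCommGroup E] {T : E → E}
    (hT : ∀ x y : E, ‖T x - T y‖ ≤ ‖x - y‖) : IsClosed {x : E | T x = x} := by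
  have hlip : LipschitzWith 1 T := LipschitzWith.of_dist_le_mul fun x y => by
    simpa [dist_eq_norm] using hT x y
  exact isClosed_eq hlip.continuous continuous_id

/-- The fixed point set of a nonexpansive map of a real inner product space is convex. -/
theorem convex_fixedPoints_of_nonexpansive {E : Type*} [NormedAddCommGroup E]
    [InnerProductSpace ℝ E] {T : E → E} (hT : ∀ x y : E, ‖T x - T y‖ ≤ ‖x - y‖) :
    Convex ℝ {x : E | T x = x} := by
  intro u hu v hv a b ha hb hab
  simp only [Set.mem_ofPred_eq] at hu hv ⊢
  obtain rfl : b = 1 - a := by linarith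
  set z := a • u + (1 - a) • v with hz
  have hzu : ‖T z - u‖ ≤ (1 - a) * ‖u - v‖ := by
    have h := hT z u
    rwa [hu, show z - u = (1 - a) • (v - u) by rw [hz]; module, norm_smul,
      Real.norm_of_nonneg hb, norm_sub_rev v u] at h
  have hzv : ‖T z - v‖ ≤ a * ‖u - v‖ := by
    have h := hT z v
    rwa [hv, show z - v = a • (u - v) by rw [hz]; module, norm_smul,
      Real.norm_of_nonneg ha] at h
  have key : ‖T z - z‖ ^ 2 =
      a * ‖T z - u‖ ^ 2 + (1 - a) * ‖T z - v‖ ^ 2 - a * (1 - a) * ‖u - v‖ ^ 2 := by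
    rw [show T z - z = a • (T z - u) + (1 - a) • (T z - v) by rw [hz]; module,
      show u - v = (T z - v) - (T z - u) by abel, norm_add_sq_real,
      norm_sub_sq_real (T z - v) (T z - u),
      norm_smul, norm_smul, inner_smul_left, inner_smul_right,
      Real.norm_of_nonneg ha, Real.norm_of_nonneg hb, real_inner_comm (T z - u) (T z - v)]
    simp only [conj_trivial]
    ring
  have hzero : ‖T z - z‖ ^ 2 ≤ 0 := by
    have h₁ := mul_le_mul_of_nonneg_left (pow_le_pow_left₀ (norm_nonneg _) hzu 2) ha
    have h₂ := mul_le_mul_of_nonneg_left (pow_le_pow_left₀ (norm_nonneg _) hzv 2) hb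
    rw [key]
    linarith
  exact sub_eq_zero.1 (norm_eq_zero.1 (pow_eq_zero_iff two_ne_zero |>.1
    (le_antisymm hzero (sq_nonneg _))))

/-- A nearest point of a convex set satisfies the variational inequality. -/
theorem inner_sub_sub_nonpos_of_nearest {E : Type*} [NormedAddCommGroup E]
    [InnerProductSpace ℝ E] {C : Set E} (hC : Convex ℝ C) {z p : E} (hp : p ∈ C)
    (hmin : ∀ w ∈ C, ‖z - p‖ ≤ ‖z - w‖) : ∀ w ∈ C, ⟪z - p, w - p⟫ ≤ 0 := by
  refine (norm_eq_iInf_iff_real_inner_le_zero hC hp).1 ?_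
  have : Nonempty C := ⟨⟨p, hp⟩⟩
  refine le_antisymm (le_ciInf fun w => hmin w w.2) ?_
  exact ciInf_le (f := fun w : C => ‖z - w‖)
    ⟨0, Set.forall_mem_range.2 fun _ => norm_nonneg _⟩ ⟨p, hp⟩

/-- The nearest points in a convex set of a Fejér monotone sequence form a Cauchy sequence. -/
theorem cauchySeq_nearest_of_fejerMonotone {E : Type*} [NormedAddCommGroup E]
    [InnerProductSpace ℝ E] {C : Set E} (hC : Convex ℝ C) {x p : ℕ → E}
    (hp : ∀ n, p n ∈ C) (hmin : ∀ n, ∀ w ∈ C, ‖x n - p n‖ ≤ ‖x n - w‖)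
    (hx : ∀ w ∈ C, Antitone fun n => ‖x n - w‖) : CauchySeq p := by
  have hpyth : ∀ n m, n ≤ m →
      ‖p m - p n‖ ^ 2 ≤ ‖x n - p n‖ ^ 2 - ‖x m - p m‖ ^ 2 := by
    intro n m hnm
    have h₁ := inner_sub_sub_nonpos_of_nearest hC (hp m) (hmin m) (p n) (hp n)
    have h₂ : ‖x m - p n‖ ^ 2 ≤ ‖x n - p n‖ ^ 2 :=
      pow_le_pow_left₀ (norm_nonneg _) (hx (p n) (hp n) hnm) 2
    rw [show x m - p n = (x m - p m) - (p n - p m) by abel, norm_sub_sq_real,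
      norm_sub_rev (p n) (p m)] at h₂
    linarith
  have hanti : Antitone fun n => ‖x n - p n‖ ^ 2 := fun n m hnm => by
    have := hpyth n m hnm
    have := sq_nonneg ‖p m - p n‖
    simp only
    linarith
  have hbdd : BddBelow (Set.range fun n => ‖x n - p n‖ ^ 2) :=
    ⟨0, Set.forall_mem_range.2 fun _ => sq_nonneg _⟩
  refine Metric.cauchySeq_iff'.2 fun ε hε => ?_
  obtain ⟨N, hN⟩ := ((tendsto_atTop_ciInf hanti hbdd).eventually_lt_const
    (lt_add_of_pos_right _ (pow_pos hε 2))).exists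
  refine ⟨N, fun n hn => ?_⟩
  have h₁ := hpyth N n hn
  have h₂ := ciInf_le hbdd n
  rw [dist_eq_norm]
  refine lt_of_pow_lt_pow_left₀ 2 hε.le ?_
  linarith

/-- If a Fejér monotone sequence converges weakly to a point of a closed convex set, then its
nearest points in that set converge to the weak limit. -/
theorem tendsto_nearest_of_fejerMonotone {E : Type*} [NormedAddCommGroup E]
    [InnerProductSpace ℝ E] [CompleteSpace E] {C : Set E} (hC : Convex ℝ C)
    (hclosed : IsClosed C) {x p : ℕ → E} {a : E}
    (hp : ∀ n, p n ∈ C) (hmin : ∀ n, ∀ w ∈ C, ‖x n - p n‖ ≤ ‖x n - w‖)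
    (hx : ∀ w ∈ C, Antitone fun n => ‖x n - w‖) (ha : a ∈ C)
    (hweak : ∀ y : E, Tendsto (fun n => ⟪x n, y⟫) atTop (nhds ⟪a, y⟫)) :
    Tendsto p atTop (nhds a) := by
  obtain ⟨u, hu⟩ := cauchySeq_tendsto_of_complete (cauchySeq_nearest_of_fejerMonotone hC hp hmin hx)
  have huC : u ∈ C := hclosed.mem_of_tendsto hu (Eventually.of_forall hp)
  have hle : ∀ n, ⟪x n, a - u⟫ - ⟪p n, a - u⟫ ≤ ‖x 0 - u‖ * ‖p n - u‖ := by
    intro n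
    have h₁ := inner_sub_sub_nonpos_of_nearest hC (hp n) (hmin n) a ha
    have h₂ : ⟪x n - p n, p n - u⟫ ≤ ‖x 0 - u‖ * ‖p n - u‖ :=
      (real_inner_le_norm _ _).trans (mul_le_mul_of_nonneg_right
        ((hmin n u huC).trans (hx u huC n.zero_le)) (norm_nonneg _))
    rw [← inner_sub_left, show a - u = (a - p n) + (p n - u) by abel, inner_add_right]
    linarith
  have hleft : Tendsto (fun n => ⟪x n, a - u⟫ - ⟪p n, a - u⟫) atTop
      (nhds (⟪a, a - u⟫ - ⟪u, a - u⟫)) :=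
    (hweak _).sub (hu.inner tendsto_const_nhds)
  have hright : Tendsto (fun n => ‖x 0 - u‖ * ‖p n - u‖) atTop (nhds (‖x 0 - u‖ * 0)) :=
    (tendsto_iff_norm_sub_tendsto_zero.1 hu).const_mul _
  have hlim := le_of_tendsto_of_tendsto' hleft hright hle
  rw [← inner_sub_left, mul_zero] at hlim
  rwa [sub_eq_zero.1 (real_inner_self_nonpos.1 hlim)]

theorem projections_converge_to_weak_limit
    {E : Type*} [NormedAddCommGroup E] [InnerProductSpace ℝ E] [CompleteSpace E]
    (T : E → E) (α : ℝ) (hα : α ∈ Set.Ioo (0 : ℝ) 1)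
    (hnonexp : ∀ x y : E, ‖T x - T y‖ ≤ ‖x - y‖)
    (hne : {x : E | T x = x}.Nonempty)
    (hT : ∀ x : E, ∀ y ∈ {x : E | T x = x},
      ‖T x - T y‖ ^ 2 + (1 - 2 * α) * ‖x - y‖ ^ 2 ≤
        2 * (1 - α) * ⟪x - y, T x - T y⟫)
    (x₀ : E) (x : ℕ → E) (hx0 : x 0 = x₀)
    (hx : ∀ n : ℕ, x (n + 1) = T (x n))
    (xstar : E) (hxstar : T xstar = xstar)
    (hweak : ∀ y : E, Tendsto (fun n => ⟪x n, y⟫) atTop (nhds ⟪xstar, y⟫))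
    (P : E → E)
    (hP : ∀ z : E, P z ∈ {x : E | T x = x} ∧
      ∀ w ∈ {x : E | T x = x}, ‖z - P z‖ ≤ ‖z - w‖) :
    ({x : E | T x = x}.Nonempty ∧ IsClosed {x : E | T x = x} ∧
        Convex ℝ {x : E | T x = x}) ∧
      Tendsto (fun n => ‖P (x n) - xstar‖) atTop (nhds 0) := by
  have hclosed := isClosed_fixedPoints_of_nonexpansive hnonexp
  have hconv := convex_fixedPoints_of_nonexpansive hnonexp
  refine ⟨⟨hne, hclosed, hconv⟩, tendsto_iff_norm_sub_tendsto_zero.1 ?_⟩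
  refine tendsto_nearest_of_fejerMonotone hconv hclosed (fun n => (hP (x n)).1)
    (fun n => (hP (x n)).2) (fun w hw => antitone_nat_of_succ_le fun n => ?_) hxstar hweak
  have h := hnonexp (x n) w
  rwa [← hx, show T w = w from hw] at h
end

section
/- Let E be a finite-dimensional real inner product space and T : E → E a nonexpansive operator that is quasi α-firmly nonexpansive for some α ∈ (0,1). Then for any x_0 ∈ E, the iterates x_n := T x_{n−1} (n ≥ 1) converge in norm to some x* ∈ Fix T. -/
open RealInnerProductSpace Filter

/-- The quasi `α`-firm nonexpansiveness inequality, rewritten in terms of the displacement. -/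
lemma one_sub_mul_norm_sub_sq_le_of_firm
    {E : Type*} [NormedAddCommGroup E] [InnerProductSpace ℝ E] {α : ℝ} {u v : E}
    (h : ‖v‖ ^ 2 + (1 - 2 * α) * ‖u‖ ^ 2 ≤ 2 * (1 - α) * ⟪u, v⟫) :
    (1 - α) * ‖u - v‖ ^ 2 ≤ α * (‖u‖ ^ 2 - ‖v‖ ^ 2) := by
  rw [norm_sub_sq_real]
  linarith

/-- The distances from the iterates of a nonexpansive map to a fixed point decrease. -/
lemma antitone_norm_iterates_sub_fixed
    {E : Type*} [SeminormedAddCommGroup E] {T : E → E}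
    (hnonexp : ∀ x y : E, ‖T x - T y‖ ≤ ‖x - y‖) {x : ℕ → E}
    (hx : ∀ n : ℕ, x (n + 1) = T (x n)) {y : E} (hy : T y = y) :
    Antitone fun n => ‖x n - y‖ :=
  antitone_nat_of_succ_le fun n => by
    simpa only [hx, hy] using hnonexp (x n) y

/-- Iterates of a quasi `α`-firmly nonexpansive, nonexpansive map are asymptotically regular. -/
lemma tendsto_iterates_sub_map_zero
    {E : Type*} [NormedAddCommGroup E] [InnerProductSpace ℝ E]
    {T : E → E} {α : ℝ} (hα : α < 1)
    (hnonexp : ∀ x y : E, ‖T x - T y‖ ≤ ‖x - y‖) {y : E} (hy : T y = y)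
    (hT : ∀ x : E, ‖T x - T y‖ ^ 2 + (1 - 2 * α) * ‖x - y‖ ^ 2 ≤
        2 * (1 - α) * ⟪x - y, T x - T y⟫)
    {x : ℕ → E} (hx : ∀ n : ℕ, x (n + 1) = T (x n)) :
    Tendsto (fun n => x n - T (x n)) atTop (nhds 0) := by
  have hanti := antitone_norm_iterates_sub_fixed hnonexp hx hy
  have hlim : Tendsto (fun n => ‖x n - y‖) atTop (nhds (⨅ n, ‖x n - y‖)) :=
    tendsto_atTop_ciInf hanti ⟨0, by rintro _ ⟨n, rfl⟩; exact norm_nonneg _⟩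
  have hdiff : Tendsto (fun n => α * (‖x n - y‖ ^ 2 - ‖x (n + 1) - y‖ ^ 2) / (1 - α))
      atTop (nhds 0) := by
    simpa using
      (((hlim.pow 2).sub (((tendsto_add_atTop_iff_nat 1).2 hlim).pow 2)).const_mul α).div_const
        (1 - α)
  have hsq : Tendsto (fun n => ‖x n - T (x n)‖ ^ 2) atTop (nhds 0) := by
    refine squeeze_zero (fun n => sq_nonneg _) (fun n => ?_) hdiff
    have h := one_sub_mul_norm_sub_sq_le_of_firm (hT (x n))
    rw [hy, sub_sub_sub_cancel_right, ← hx] at h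
    rw [← hx, le_div_iff₀ (sub_pos.2 hα)]
    linarith
  rw [tendsto_zero_iff_norm_tendsto_zero]
  simpa using hsq.sqrt

theorem iterates_strong_convergence_finite_dim
    {E : Type*} [NormedAddCommGroup E] [InnerProductSpace ℝ E]
    [FiniteDimensional ℝ E]
    (T : E → E) (α : ℝ) (hα : α ∈ Set.Ioo (0 : ℝ) 1)
    (hnonexp : ∀ x y : E, ‖T x - T y‖ ≤ ‖x - y‖)
    (hne : {x : E | T x = x}.Nonempty)
    (hT : ∀ x : E, ∀ y ∈ {x : E | T x = x},
      ‖T x - T y‖ ^ 2 + (1 - 2 * α) * ‖x - y‖ ^ 2 ≤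
        2 * (1 - α) * ⟪x - y, T x - T y⟫)
    (x₀ : E) (x : ℕ → E) (hx0 : x 0 = x₀)
    (hx : ∀ n : ℕ, x (n + 1) = T (x n)) :
    ∃ xstar ∈ {x : E | T x = x}, Tendsto x atTop (nhds xstar) := by
  obtain ⟨y, hy⟩ := hne
  have hreg := tendsto_iterates_sub_map_zero hα.2 hnonexp hy (fun z => hT z y hy) hx
  have hcont : Continuous T :=
    (LipschitzWith.of_dist_le_mul (K := 1) fun a b => by
      simpa [dist_eq_norm] using hnonexp a b).continuous
  have : ProperSpace E := FiniteDimensional.proper ℝ E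
  have hbdd : ∀ n, x n ∈ Metric.closedBall y ‖x 0 - y‖ := fun n => by
    rw [mem_closedBall_iff_norm]
    exact antitone_norm_iterates_sub_fixed hnonexp hx hy (Nat.zero_le n)
  obtain ⟨p, -, φ, hφ, hp⟩ := (isCompact_closedBall y ‖x 0 - y‖).tendsto_subseq hbdd
  have hfix : T p = p := by
    have h := hp.sub ((hcont.tendsto p).comp hp)
    exact (sub_eq_zero.1 (tendsto_nhds_unique h (hreg.comp hφ.tendsto_atTop))).symm
  refine ⟨p, hfix, tendsto_iff_norm_sub_tendsto_zero.2 ?_⟩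
  exact (tendsto_iff_tendsto_subseq_of_antitone
    (antitone_norm_iterates_sub_fixed hnonexp hx hfix) hφ.tendsto_atTop).2
    (tendsto_iff_norm_sub_tendsto_zero.1 hp)
end

section
/- Let C_1, …, C_N be nonempty closed convex subsets of a real Hilbert space E with C := ⋂_{i=1}^N C_i ≠ ∅, and let P_i denote the metric projection onto C_i. Given x_0 ∈ E, define the cyclic projection sequence x_n := P_{[n]} x_{n−1} for n ≥ 1, where [n] := (n mod N) + 1. Then (x_n)_{n≥0} converges weakly to some element x* ∈ C. -/
open RealInnerProductSpace Filter

section WeakLimits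

variable {ι E : Type*} [NormedAddCommGroup E] [InnerProductSpace ℝ E]

/-- A bounded family in a Hilbert space converges weakly along every ultrafilter. -/
theorem exists_weak_limit_of_bounded [CompleteSpace E] (U : Ultrafilter ι) {x : ι → E} {R : ℝ}
    (hR : ∀ n, ‖x n‖ ≤ R) :
    ∃ z : E, ∀ y : E, Tendsto (fun n => ⟪x n, y⟫) U (nhds ⟪z, y⟫) := by
  let f : ι → WeakDual ℝ E := fun n => StrongDual.toWeakDual (InnerProductSpace.toDual ℝ E (x n))
  have hf : ∀ n, f n ∈ WeakDual.toStrongDual ⁻¹' Metric.closedBall (0 : StrongDual ℝ E) R := by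
    intro n
    simpa [f] using hR n
  obtain ⟨φ, -, hφ⟩ := (WeakDual.isCompact_closedBall (0 : StrongDual ℝ E) R).ultrafilter_le_nhds
    (U.map f) (le_principal_iff.2 (mem_map.2 (univ_mem' hf)))
  refine ⟨(InnerProductSpace.toDual ℝ E).symm (WeakDual.toStrongDual φ), fun y => ?_⟩
  have h : Tendsto (fun n => f n y) U (nhds (φ y)) :=
    ((WeakDual.eval_continuous y).tendsto φ).comp hφ
  simpa [f] using h

/-- The variational inequality for nearest points of a convex set. -/
theorem inner_sub_le_zero_of_nearest {K : Set E} (hK : Convex ℝ K) {u v : E} (hv : v ∈ K)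
    (hmin : ∀ w ∈ K, ‖u - v‖ ≤ ‖u - w‖) : ∀ w ∈ K, ⟪u - v, w - v⟫ ≤ 0 := by
  refine (norm_eq_iInf_iff_real_inner_le_zero hK hv).1 (le_antisymm ?_ ?_)
  · have : Nonempty K := ⟨⟨v, hv⟩⟩
    exact le_ciInf fun w => hmin w w.2
  · exact ciInf_le ⟨0, by rintro _ ⟨w, rfl⟩; exact norm_nonneg _⟩ (⟨v, hv⟩ : K)

/-- Projecting onto a convex set decreases the squared distance to its points by at least the
squared displacement. -/
theorem norm_sub_sq_add_norm_sub_sq_le_of_nearest {K : Set E} (hK : Convex ℝ K) {u v c : E}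
    (hv : v ∈ K) (hmin : ∀ w ∈ K, ‖u - v‖ ≤ ‖u - w‖) (hc : c ∈ K) :
    ‖v - c‖ ^ 2 + ‖v - u‖ ^ 2 ≤ ‖u - c‖ ^ 2 := by
  have h := inner_sub_le_zero_of_nearest hK hv hmin c hc
  have e : u - c = (u - v) - (c - v) := by abel
  rw [e, norm_sub_sq_real (u - v), norm_sub_rev v c, norm_sub_rev v u]
  linarith

/-- If a family approaches a closed convex set, its weak limit lies in that set. -/
theorem mem_of_weak_limit [CompleteSpace E] {l : Filter ι} [l.NeBot] {K : Set E} (hKc : IsClosed K)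
    (hKv : Convex ℝ K) {x p : ι → E} {z : E}
    (hx : ∀ y : E, Tendsto (fun n => ⟪x n, y⟫) l (nhds ⟪z, y⟫))
    (hp : ∀ n, p n ∈ K) (hpx : Tendsto (fun n => p n - x n) l (nhds 0)) : z ∈ K := by
  obtain ⟨n₀⟩ : Nonempty ι := l.nonempty_of_neBot
  obtain ⟨q, hq, hqz⟩ := exists_norm_eq_iInf_of_complete_convex ⟨p n₀, hp n₀⟩ hKc.isComplete hKv z
  have hvar := (norm_eq_iInf_iff_real_inner_le_zero hKv hq).1 hqz
  have hlim : Tendsto (fun n => ⟪z - q, p n - q⟫) l (nhds ⟪z - q, z - q⟫) := by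
    have h₁ : Tendsto (fun n => ⟪z - q, p n - x n⟫) l (nhds ⟪z - q, (0 : E)⟫) :=
      tendsto_const_nhds.inner hpx
    have h₂ := (h₁.add (hx (z - q))).sub_const ⟪z - q, q⟫
    convert h₂ using 2
    · rw [real_inner_comm (z - q) (x _), ← inner_add_right, ← inner_sub_right]
      congr 1; abel
    · rw [inner_zero_right, zero_add, real_inner_comm (z - q) z, ← inner_sub_right]
  have hle : ⟪z - q, z - q⟫ ≤ 0 := le_of_tendsto' hlim fun n => hvar _ (hp n)
  rw [real_inner_self_nonpos, sub_eq_zero] at hle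
  exact hle ▸ hq

/-- Opial's lemma: if the distances to all points of `S` converge and every weak limit along an
ultrafilter lies in `S`, then the family converges weakly to a point of `S`. -/
theorem exists_weak_limit_of_tendsto_norm_sub [CompleteSpace E] {l : Filter ι} [l.NeBot]
    {S : Set E} {x : ι → E} {R : ℝ} (hR : ∀ n, ‖x n‖ ≤ R)
    (hdist : ∀ c ∈ S, ∃ d : ℝ, Tendsto (fun n => ‖x n - c‖ ^ 2) l (nhds d))
    (hS : ∀ U : Ultrafilter ι, (U : Filter ι) ≤ l → ∀ z : E,
      (∀ y : E, Tendsto (fun n => ⟪x n, y⟫) U (nhds ⟪z, y⟫)) → z ∈ S) :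
    ∃ z ∈ S, ∀ y : E, Tendsto (fun n => ⟪x n, y⟫) l (nhds ⟪z, y⟫) := by
  obtain ⟨z, hz⟩ := exists_weak_limit_of_bounded (Ultrafilter.of l) hR
  have hzS := hS _ (Ultrafilter.of_le l) z hz
  refine ⟨z, hzS, fun y => tendsto_iff_ultrafilter _ _ _ |>.2 fun V hV => ?_⟩
  obtain ⟨w, hw⟩ := exists_weak_limit_of_bounded V hR
  have hwS := hS V hV w hw
  obtain ⟨a, ha⟩ := hdist z hzS
  obtain ⟨b, hb⟩ := hdist w hwS
  have hconv : Tendsto (fun n => ⟪x n, z - w⟫) l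
      (nhds ((b - a + (‖z‖ ^ 2 - ‖w‖ ^ 2)) / 2)) := by
    convert ((hb.sub ha).add_const (‖z‖ ^ 2 - ‖w‖ ^ 2)).div_const 2 using 2
    rw [norm_sub_sq_real, norm_sub_sq_real, inner_sub_right]
    ring
  have h₁ := tendsto_nhds_unique (hz (z - w)) (hconv.mono_left (Ultrafilter.of_le l))
  have h₂ := tendsto_nhds_unique (hw (z - w)) (hconv.mono_left hV)
  have hzw : z = w := by
    rw [← sub_eq_zero, ← inner_self_eq_zero (𝕜 := ℝ), inner_sub_left, h₁, h₂, sub_self]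
  exact hzw ▸ hw y

end WeakLimits

/-- If consecutive differences vanish, so do differences with a bounded index shift. -/
theorem tendsto_sub_of_bounded_shift {E : Type*} [SeminormedAddCommGroup E] {x : ℕ → E}
    (hx : Tendsto (fun n => ‖x (n + 1) - x n‖) atTop (nhds 0)) {k : ℕ → ℕ} {M : ℕ}
    (hk : ∀ n, k n ≤ M) : Tendsto (fun n => x (n + k n) - x n) atTop (nhds 0) := by
  have hsum : Tendsto (fun n => ∑ j ∈ Finset.range M, ‖x (n + j + 1) - x (n + j)‖) atTop
      (nhds 0) := by
    simpa using tendsto_finsetSum (Finset.range M) fun j _ => hx.comp (tendsto_add_atTop_nat j)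
  refine squeeze_zero_norm (fun n => ?_) hsum
  calc ‖x (n + k n) - x n‖
      = ‖∑ j ∈ Finset.range (k n), (x (n + j + 1) - x (n + j))‖ := by
        exact congrArg norm (Finset.sum_range_sub (fun j => x (n + j)) (k n)).symm
    _ ≤ ∑ j ∈ Finset.range (k n), ‖x (n + j + 1) - x (n + j)‖ := norm_sum_le _ _
    _ ≤ _ := Finset.sum_le_sum_of_subset_of_nonneg (Finset.range_mono (hk n))
        fun _ _ _ => norm_nonneg _

theorem Nat.exists_lt_add_mod_eq {N r : ℕ} (hr : r < N) (m : ℕ) : ∃ k < N, (m + k) % N = r := by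
  have hm := Nat.mod_lt m (r.zero_le.trans_lt hr)
  refine ⟨(r + (N - m % N)) % N, Nat.mod_lt _ (r.zero_le.trans_lt hr), ?_⟩
  rw [Nat.add_mod_mod, ← Nat.mod_add_mod, show m % N + (r + (N - m % N)) = r + N by omega,
    Nat.add_mod_right, Nat.mod_eq_of_lt hr]

theorem cyclic_projections_weak_convergence
    {E : Type*} [NormedAddCommGroup E] [InnerProductSpace ℝ E] [CompleteSpace E]
    (N : ℕ) (hN : 0 < N) (C : ℕ → Set E)
    (hCne : ∀ i ∈ Set.Icc 1 N, (C i).Nonempty)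
    (hCc : ∀ i ∈ Set.Icc 1 N, IsClosed (C i))
    (hCv : ∀ i ∈ Set.Icc 1 N, Convex ℝ (C i))
    (hinter : (⋂ i ∈ Set.Icc 1 N, C i).Nonempty)
    (P : ℕ → E → E)
    (hP : ∀ i ∈ Set.Icc 1 N, ∀ x : E, P i x ∈ C i ∧ ∀ y ∈ C i, ‖x - P i x‖ ≤ ‖x - y‖)
    (x₀ : E) (x : ℕ → E) (hx0 : x 0 = x₀)
    (hx : ∀ n : ℕ, x (n + 1) = P ((n + 1) % N + 1) (x n)) :
    ∃ xstar ∈ ⋂ i ∈ Set.Icc 1 N, C i,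
      ∀ y : E, Tendsto (fun n => ⟪x n, y⟫) atTop (nhds ⟪xstar, y⟫) := by
  have hidx (n : ℕ) : (n + 1) % N + 1 ∈ Set.Icc 1 N :=
    ⟨Nat.le_add_left _ _, Nat.mod_lt _ hN⟩
  have hmem (n : ℕ) : x (n + 1) ∈ C ((n + 1) % N + 1) := hx n ▸ (hP _ (hidx n) _).1
  have hstep : ∀ c ∈ ⋂ i ∈ Set.Icc 1 N, C i, ∀ n,
      ‖x (n + 1) - c‖ ^ 2 + ‖x (n + 1) - x n‖ ^ 2 ≤ ‖x n - c‖ ^ 2 := fun c hc n =>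
    norm_sub_sq_add_norm_sub_sq_le_of_nearest (hCv _ (hidx n)) (hmem n)
      (hx n ▸ (hP _ (hidx n) _).2) (Set.mem_iInter₂.1 hc _ (hidx n))
  have hanti : ∀ c ∈ ⋂ i ∈ Set.Icc 1 N, C i, Antitone fun n => ‖x n - c‖ ^ 2 := fun c hc =>
    antitone_nat_of_succ_le fun n => by nlinarith [hstep c hc n, sq_nonneg ‖x (n + 1) - x n‖]
  have hdist : ∀ c ∈ ⋂ i ∈ Set.Icc 1 N, C i,
      ∃ d : ℝ, Tendsto (fun n => ‖x n - c‖ ^ 2) atTop (nhds d) := fun c hc =>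
    ⟨_, tendsto_atTop_ciInf (hanti c hc) ⟨0, by rintro _ ⟨n, rfl⟩; positivity⟩⟩
  obtain ⟨c, hc⟩ := hinter
  have hR (n : ℕ) : ‖x n‖ ≤ ‖x 0 - c‖ + ‖c‖ := by
    have h : ‖x n - c‖ ≤ ‖x 0 - c‖ :=
      (sq_le_sq₀ (norm_nonneg _) (norm_nonneg _)).1 (hanti c hc n.zero_le)
    linarith [norm_le_norm_sub_add (x n) c]
  have hdiff : Tendsto (fun n => ‖x (n + 1) - x n‖) atTop (nhds 0) := by
    obtain ⟨d, hd⟩ := hdist c hc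
    have hsq : Tendsto (fun n => ‖x (n + 1) - x n‖ ^ 2) atTop (nhds 0) := by
      refine squeeze_zero (fun n => sq_nonneg _) (fun n => le_sub_iff_add_le'.2 (hstep c hc n)) ?_
      simpa using hd.sub (hd.comp (tendsto_add_atTop_nat 1))
    simpa [Real.sqrt_sq] using hsq.sqrt
  refine exists_weak_limit_of_tendsto_norm_sub hR hdist fun U hU z hz =>
    Set.mem_iInter₂.2 fun i hi => ?_
  have hi' : i - 1 < N := by have := hi.1; have := hi.2; omega
  choose k hkN hk using fun n => Nat.exists_lt_add_mod_eq hi' (n + 1)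
  refine mem_of_weak_limit (p := fun n => x (n + (k n + 1))) (hCc i hi) (hCv i hi) hz (fun n => ?_)
    ((tendsto_sub_of_bounded_shift hdiff fun n => hkN n).mono_left hU)
  have h := hmem (n + k n)
  rwa [show n + k n + 1 = n + 1 + k n by omega, hk, Nat.sub_add_cancel hi.1,
    show n + 1 + k n = n + (k n + 1) by omega] at h
end
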